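/- Region-level dichotomy for competing delays (the timing core of the lemma that regions beat regions): let κ₀ be a clock valuation and let R₁, R₂ be regions such that there exist Δ₁, Δ₂ ∈ ℝ≥0 with κ₀+Δ₁ ∈ R₁ and κ₀+Δ₂ ∈ R₂. Then one of the following two cases holds: (1) for every valuation κ with κ ≅ κ₀ there exists Δ₁ ∈ ℝ≥0 with κ+Δ₁ ∈ R₁ such that every Δ₂ ∈ ℝ≥0 with κ+Δ₂ ∈ R₂ satisfies Δ₁ < Δ₂; or (2) for every valuation κ with κ ≅ κ₀ and every Δ₁ ∈ ℝ≥0 with κ+Δ₁ ∈ R₁, there exists Δ₂ ∈ ℝ≥0 with Δ₂ ≤ Δ₁ and κ+Δ₂ ∈ R₂. -/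

import Mathlib

open scoped NNReal

/-- Region equivalence of clock valuations with respect to clock bounds `c`. -/
def RegionEquiv {C : Type*} (c : C → ℕ) (κ₁ κ₂ : C → ℝ≥0) : Prop :=
  (∀ x, (κ₁ x : ℝ) ≤ c x ↔ (κ₂ x : ℝ) ≤ c x) ∧
  (∀ x, (κ₁ x : ℝ) ≤ c x → ⌊(κ₁ x : ℝ)⌋ = ⌊(κ₂ x : ℝ)⌋) ∧
  (∀ x y, (κ₁ x : ℝ) ≤ c x → (κ₁ y : ℝ) ≤ c y →
    (Int.fract (κ₁ x : ℝ) ≤ Int.fract (κ₁ y : ℝ) ↔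
     Int.fract (κ₂ x : ℝ) ≤ Int.fract (κ₂ y : ℝ))) ∧
  (∀ x, (κ₁ x : ℝ) ≤ c x → (Int.fract (κ₁ x : ℝ) = 0 ↔ Int.fract (κ₂ x : ℝ) = 0))

/-- A region is an equivalence class of region equivalence. -/
def IsRegion {C : Type*} (c : C → ℕ) (R : Set (C → ℝ≥0)) : Prop :=
  ∃ κ, R = {κ' | RegionEquiv c κ κ'}

/-- A bound by an integer only depends on the integer part and on the vanishing of the
fractional part. -/
theorem le_natCast_iff_of_floor_eq {u v : ℝ} (hfloor : ⌊u⌋ = ⌊v⌋)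
    (hfract : Int.fract u = 0 ↔ Int.fract v = 0) (n : ℕ) : u ≤ n ↔ v ≤ n := by
  have key : ∀ {u v : ℝ}, ⌊u⌋ = ⌊v⌋ → (Int.fract u = 0 ↔ Int.fract v = 0) →
      u ≤ n → v ≤ n := by
    intro u v hfl hfr hu
    have hu' := Int.floor_add_fract u
    have hv' := Int.floor_add_fract v
    have hv1 := Int.fract_lt_one v
    have hu0 := Int.fract_nonneg u
    rw [hfl] at hu'
    by_cases h0 : Int.fract u = 0
    · have := hfr.1 h0
      linarith
    · have hpos : 0 < Int.fract u := lt_of_le_of_ne hu0 (Ne.symm h0)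
      have hlt : (⌊v⌋ : ℝ) < (n : ℤ) := by push_cast; linarith
      have hle : ⌊v⌋ + 1 ≤ (n : ℤ) := by exact_mod_cast hlt
      have hle' : (⌊v⌋ : ℝ) + 1 ≤ n := by exact_mod_cast hle
      linarith
  exact ⟨key hfloor hfract, key hfloor.symm hfract.symm⟩

theorem floor_fract_add_of_lt {a d : ℝ} (h : Int.fract a + Int.fract d < 1) :
    ⌊a + d⌋ = ⌊a⌋ + ⌊d⌋ ∧ Int.fract (a + d) = Int.fract a + Int.fract d := by
  have ha := Int.floor_add_fract a
  have hd := Int.floor_add_fract d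
  have hfl : ⌊a + d⌋ = ⌊a⌋ + ⌊d⌋ := by
    rw [Int.floor_eq_iff]
    push_cast
    constructor <;> linarith [Int.fract_nonneg a, Int.fract_nonneg d]
  refine ⟨hfl, ?_⟩
  rw [← Int.self_sub_floor, hfl]
  push_cast
  linarith

theorem floor_fract_add_of_le {a d : ℝ} (h : 1 ≤ Int.fract a + Int.fract d) :
    ⌊a + d⌋ = ⌊a⌋ + ⌊d⌋ + 1 ∧ Int.fract (a + d) = Int.fract a + Int.fract d - 1 := by
  have ha := Int.floor_add_fract a
  have hd := Int.floor_add_fract d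
  have hfl : ⌊a + d⌋ = ⌊a⌋ + ⌊d⌋ + 1 := by
    rw [Int.floor_eq_iff]
    push_cast
    constructor <;> linarith [Int.fract_lt_one a, Int.fract_lt_one d]
  refine ⟨hfl, ?_⟩
  rw [← Int.self_sub_floor, hfl]
  push_cast
  linarith

/-- Two finite families in `[0, 1)` with the same order pattern and the same zeros realise the
same cuts at points of `(0, 1]`. -/
theorem exists_cut_of_order_iff {ι : Type*} [Finite ι] {f f' : ι → ℝ}
    (hf' : ∀ i, f' i ∈ Set.Ico 0 1)
    (hord : ∀ i j, f i ≤ f j ↔ f' i ≤ f' j) (hzero : ∀ i, f i = 0 ↔ f' i = 0)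
    {g : ℝ} (hg : 0 < g) (hg1 : g < 1) :
    ∃ g', 0 < g' ∧ g' < 1 ∧ ∀ i, (f i < g ↔ f' i < g') ∧ (f i = g ↔ f' i = g') := by
  classical
  have := Fintype.ofFinite ι
  by_cases hex : ∃ j, f j = g
  · obtain ⟨j, rfl⟩ := hex
    refine ⟨f' j, lt_of_le_of_ne (hf' j).1 fun h => hg.ne' ((hzero j).2 h.symm), (hf' j).2,
      fun i => ⟨?_, ?_⟩⟩
    · rw [← not_le, ← not_le, hord]
    · rw [le_antisymm_iff, le_antisymm_iff, hord, hord]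
  · push Not at hex
    obtain ⟨m, hlo, hhi⟩ := Order.exists_between_finsets
      (lo := insert 0 (({i | f i < g} : Finset ι).image f'))
      (hi := insert 1 (({i | g < f i} : Finset ι).image f')) (by
        intro a ha b hb
        simp only [Finset.mem_insert, Finset.mem_image, Finset.mem_filter, Finset.mem_univ,
          true_and] at ha hb
        rcases ha with rfl | ⟨i, hi, rfl⟩ <;> rcases hb with rfl | ⟨j, hj, rfl⟩
        · exact zero_lt_one
        · exact lt_of_le_of_ne (hf' j).1 fun h => (hg.trans hj).ne' ((hzero j).2 h.symm)
        · exact (hf' i).2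
        · exact not_le.1 fun h => not_le.2 (hi.trans hj) ((hord j i).2 h))
    have hlt : ∀ i, f i < g → f' i < m := fun i hi =>
      hlo _ (Finset.mem_insert_of_mem (Finset.mem_image_of_mem _ (by simpa using hi)))
    have hgt : ∀ i, g < f i → m < f' i := fun i hi =>
      hhi _ (Finset.mem_insert_of_mem (Finset.mem_image_of_mem _ (by simpa using hi)))
    refine ⟨m, hlo _ (Finset.mem_insert_self _ _), hhi _ (Finset.mem_insert_self _ _),
      fun i => ?_⟩
    rcases lt_or_gt_of_ne (hex i) with hi | hi
    · exact ⟨iff_of_true hi (hlt i hi), iff_of_false hi.ne (hlt i hi).ne⟩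
    · exact ⟨iff_of_false hi.le.not_gt (hgt i hi).le.not_gt, iff_of_false hi.ne' (hgt i hi).ne'⟩

namespace RegionEquiv

variable {C : Type*} {c : C → ℕ} {κ κ₁ κ₂ κ₃ : C → ℝ≥0}

theorem symm (h : RegionEquiv c κ₁ κ₂) : RegionEquiv c κ₂ κ₁ := by
  obtain ⟨ha, hb, hc, hd⟩ := h
  exact ⟨fun x => (ha x).symm, fun x hx => (hb x ((ha x).2 hx)).symm,
    fun x y hx hy => (hc x y ((ha x).2 hx) ((ha y).2 hy)).symm,
    fun x hx => (hd x ((ha x).2 hx)).symm⟩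

theorem trans (h : RegionEquiv c κ₁ κ₂) (h' : RegionEquiv c κ₂ κ₃) : RegionEquiv c κ₁ κ₃ := by
  obtain ⟨ha, hb, hc, hd⟩ := h
  obtain ⟨ha', hb', hc', hd'⟩ := h'
  exact ⟨fun x => (ha x).trans (ha' x), fun x hx => (hb x hx).trans (hb' x ((ha x).1 hx)),
    fun x y hx hy => (hc x y hx hy).trans (hc' x y ((ha x).1 hx) ((ha y).1 hy)),
    fun x hx => (hd x hx).trans (hd' x ((ha x).1 hx))⟩

/-- The delays leading from a valuation into a region form a convex set. -/
theorem add_of_le_of_le {a m b : ℝ≥0}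
    (h : RegionEquiv c (fun x => κ x + a) (fun x => κ x + b)) (ham : a ≤ m) (hmb : m ≤ b) :
    RegionEquiv c (fun x => κ x + a) (fun x => κ x + m) := by
  obtain ⟨ha, hb, -, hd⟩ := h
  have ham' : (a : ℝ) ≤ m := ham
  have hmb' : (m : ℝ) ≤ b := hmb
  simp only [NNReal.coe_add] at ha hb hd
  have hfloor : ∀ x, (κ x + a : ℝ) ≤ c x → ⌊(κ x + a : ℝ)⌋ = ⌊(κ x + m : ℝ)⌋ := fun x hx =>
    le_antisymm (Int.floor_mono (by linarith))
      ((Int.floor_mono (by linarith)).trans (hb x hx).ge)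
  refine ⟨fun x => ?_, ?_, fun x y hx hy => ?_, fun x hx => ?_⟩ <;>
    simp only [NNReal.coe_add] at *
  · exact ⟨fun hx => by linarith [(ha x).1 hx], fun hx => by linarith⟩
  · exact hfloor
  · simp only [← Int.self_sub_floor, ← hfloor x hx, ← hfloor y hy]
    constructor <;> intro <;> linarith
  · have hfl := hfloor x hx
    have hflb := hb x hx
    constructor
    · intro h0
      have h1 := (hd x hx).1 h0
      rw [← Int.self_sub_floor] at h0 h1 ⊢
      rw [← hflb] at h1
      rw [← hfl]
      linarith
    · intro h0
      rw [← Int.self_sub_floor, ← hfl] at h0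
      have := Int.fract_nonneg (κ x + a : ℝ)
      rw [← Int.self_sub_floor] at this ⊢
      linarith

/-- Delays cutting the fractional parts in the same way preserve region equivalence. -/
theorem add_of_cut {d d' : ℝ≥0} (h : RegionEquiv c κ₁ κ₂) (hfloor : ⌊(d : ℝ)⌋ = ⌊(d' : ℝ)⌋)
    (hcut : ∀ x, (κ₁ x : ℝ) ≤ c x →
      (Int.fract (κ₁ x : ℝ) + Int.fract (d : ℝ) < 1 ↔
        Int.fract (κ₂ x : ℝ) + Int.fract (d' : ℝ) < 1) ∧
      (Int.fract (κ₁ x : ℝ) + Int.fract (d : ℝ) = 1 ↔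
        Int.fract (κ₂ x : ℝ) + Int.fract (d' : ℝ) = 1))
    (hzero : Int.fract (d : ℝ) = 0 ↔ Int.fract (d' : ℝ) = 0) :
    RegionEquiv c (fun x => κ₁ x + d) (fun x => κ₂ x + d') := by
  obtain ⟨hle, hfl, hord, hz⟩ := h
  have hbound : ∀ {κ : C → ℝ≥0} {e : ℝ≥0} {x}, (κ x + e : ℝ) ≤ c x → (κ x : ℝ) ≤ c x :=
    fun {κ e x} hx => by linarith [e.coe_nonneg]
  have hcases : ∀ x, (κ₁ x : ℝ) ≤ c x →
      (⌊(κ₁ x + d : ℝ)⌋ = ⌊(κ₂ x + d' : ℝ)⌋) ∧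
      (Int.fract (κ₁ x + d : ℝ) = 0 ↔ Int.fract (κ₂ x + d' : ℝ) = 0) := by
    intro x hx
    obtain ⟨hlt, heq⟩ := hcut x hx
    have h1 := Int.fract_nonneg (κ₁ x : ℝ)
    have h2 := Int.fract_nonneg (κ₂ x : ℝ)
    have h3 := Int.fract_nonneg (d : ℝ)
    have h4 := Int.fract_nonneg (d' : ℝ)
    by_cases hw : Int.fract (κ₁ x : ℝ) + Int.fract (d : ℝ) < 1
    · obtain ⟨e1, e2⟩ := floor_fract_add_of_lt hw
      obtain ⟨e3, e4⟩ := floor_fract_add_of_lt (hlt.1 hw)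
      rw [e1, e2, e3, e4, hfl x hx, hfloor, add_eq_zero_iff_of_nonneg h1 h3,
        add_eq_zero_iff_of_nonneg h2 h4, hz x hx, hzero]
      exact ⟨rfl, Iff.rfl⟩
    · obtain ⟨e1, e2⟩ := floor_fract_add_of_le (not_lt.1 hw)
      obtain ⟨e3, e4⟩ := floor_fract_add_of_le (not_lt.1 (mt hlt.2 hw))
      rw [e1, e2, e3, e4, hfl x hx, hfloor, sub_eq_zero, sub_eq_zero]
      exact ⟨rfl, heq⟩
  refine ⟨fun x => ?_, fun x hx => ?_, fun x y hx hy => ?_, fun x hx => ?_⟩ <;>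
    simp only [NNReal.coe_add] at *
  · by_cases hx : (κ₁ x : ℝ) ≤ c x
    · exact le_natCast_iff_of_floor_eq (hcases x hx).1 (hcases x hx).2 _
    · exact iff_of_false (mt hbound hx) (mt hbound (mt (hle x).2 hx))
  · exact (hcases x (hbound hx)).1
  · have hx' := hbound hx
    have hy' := hbound hy
    have hltx := (hcut x hx').1
    have hlty := (hcut y hy').1
    have hxy := hord x y hx' hy'
    have hnn := fun z => Int.fract_nonneg (κ₁ z : ℝ)
    have hnn' := fun z => Int.fract_nonneg (κ₂ z : ℝ)
    have hl := fun z => Int.fract_lt_one (κ₁ z : ℝ)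
    have hl' := fun z => Int.fract_lt_one (κ₂ z : ℝ)
    by_cases hwx : Int.fract (κ₁ x : ℝ) + Int.fract (d : ℝ) < 1 <;>
    by_cases hwy : Int.fract (κ₁ y : ℝ) + Int.fract (d : ℝ) < 1
    · rw [(floor_fract_add_of_lt hwx).2, (floor_fract_add_of_lt hwy).2,
        (floor_fract_add_of_lt (hltx.1 hwx)).2, (floor_fract_add_of_lt (hlty.1 hwy)).2,
        add_le_add_iff_right, add_le_add_iff_right, hxy]
    · rw [(floor_fract_add_of_lt hwx).2, (floor_fract_add_of_le (not_lt.1 hwy)).2,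
        (floor_fract_add_of_lt (hltx.1 hwx)).2,
        (floor_fract_add_of_le (not_lt.1 (mt hlty.2 hwy))).2]
      apply iff_of_false <;> linarith [hnn x, hnn' x, hl y, hl' y]
    · rw [(floor_fract_add_of_le (not_lt.1 hwx)).2, (floor_fract_add_of_lt hwy).2,
        (floor_fract_add_of_le (not_lt.1 (mt hltx.2 hwx))).2,
        (floor_fract_add_of_lt (hlty.1 hwy)).2]
      apply iff_of_true <;> linarith [hnn y, hnn' y, hl x, hl' x]
    · rw [(floor_fract_add_of_le (not_lt.1 hwx)).2, (floor_fract_add_of_le (not_lt.1 hwy)).2,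
        (floor_fract_add_of_le (not_lt.1 (mt hltx.2 hwx))).2,
        (floor_fract_add_of_le (not_lt.1 (mt hlty.2 hwy))).2,
        sub_le_sub_iff_right, sub_le_sub_iff_right, add_le_add_iff_right,
        add_le_add_iff_right, hxy]
  · exact (hcases x (hbound hx)).2

/-- Region equivalence is a time-abstract simulation. -/
theorem exists_delay [Finite C] (h : RegionEquiv c κ₁ κ₂) (d : ℝ≥0) :
    ∃ d' : ℝ≥0, RegionEquiv c (fun x => κ₁ x + d) (fun x => κ₂ x + d') := by
  by_cases hd0 : Int.fract (d : ℝ) = 0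
  · refine ⟨d, h.add_of_cut rfl (fun x _ => ?_) Iff.rfl⟩
    have h1 := Int.fract_lt_one (κ₁ x : ℝ)
    have h2 := Int.fract_lt_one (κ₂ x : ℝ)
    simp only [hd0, add_zero]
    exact ⟨iff_of_true h1 h2, iff_of_false h1.ne h2.ne⟩
  have hdpos : 0 < Int.fract (d : ℝ) := lt_of_le_of_ne (Int.fract_nonneg _) (Ne.symm hd0)
  obtain ⟨g, hg0, hg1, hg⟩ := exists_cut_of_order_iff
    (ι := {x // (κ₁ x : ℝ) ≤ c x}) (f := fun x => Int.fract (κ₁ x : ℝ))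
    (f' := fun x => Int.fract (κ₂ x : ℝ)) (g := 1 - Int.fract (d : ℝ))
    (fun x => ⟨Int.fract_nonneg _, Int.fract_lt_one _⟩)
    (fun x y => h.2.2.1 x y x.2 y.2) (fun x => h.2.2.2 x x.2)
    (sub_pos.2 (Int.fract_lt_one _)) (sub_lt_self _ hdpos)
  have hfl0 : (0 : ℝ) ≤ ⌊(d : ℝ)⌋ := by exact_mod_cast Int.floor_nonneg.2 d.coe_nonneg
  have hfract : Int.fract (⌊(d : ℝ)⌋ + (1 - g)) = 1 - g := by
    rw [Int.fract_intCast_add, Int.fract_eq_self]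
    constructor <;> linarith
  obtain ⟨d', hd'⟩ : ∃ d' : ℝ≥0, (d' : ℝ) = ⌊(d : ℝ)⌋ + (1 - g) :=
    ⟨⟨⌊(d : ℝ)⌋ + (1 - g), by linarith⟩, rfl⟩
  rw [← hd'] at hfract
  refine ⟨d', h.add_of_cut ?_ (fun x hx => ?_) ?_⟩
  · rw [hd', Int.floor_intCast_add, left_eq_add, Int.floor_eq_zero_iff]
    constructor <;> linarith
  · obtain ⟨hlt, heq⟩ := hg ⟨x, hx⟩
    rw [lt_sub_iff_add_lt] at hlt
    rw [eq_sub_iff_add_eq] at heq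
    rw [hlt, heq, hfract]
    constructor <;> constructor <;> intro <;> linarith
  · exact iff_of_false hd0 (by rw [hfract]; linarith)

/-- Region equivalence simulates two successive delays. -/
theorem exists_delay_pair [Finite C] (h : RegionEquiv c κ₁ κ₂) {a b : ℝ≥0} (hab : a ≤ b) :
    ∃ a' b' : ℝ≥0, a' ≤ b' ∧ RegionEquiv c (fun x => κ₁ x + a) (fun x => κ₂ x + a') ∧
      RegionEquiv c (fun x => κ₁ x + b) (fun x => κ₂ x + b') := by
  obtain ⟨a', ha'⟩ := h.exists_delay a
  obtain ⟨e, he⟩ := ha'.exists_delay (b - a)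
  refine ⟨a', a' + e, le_self_add, ha', ?_⟩
  simpa only [add_assoc, add_tsub_cancel_of_le hab] using he

end RegionEquiv

/-- Region-level dichotomy for competing delays. -/
theorem regions_beat_regions
    {C : Type*} [Fintype C] (c : C → ℕ) (hc : ∀ x, 0 < c x)
    (κ₀ : C → ℝ≥0) (R₁ R₂ : Set (C → ℝ≥0))
    (hR₁ : IsRegion c R₁) (hR₂ : IsRegion c R₂)
    (h₁ : ∃ Δ₁ : ℝ≥0, (fun x => κ₀ x + Δ₁) ∈ R₁)
    (h₂ : ∃ Δ₂ : ℝ≥0, (fun x => κ₀ x + Δ₂) ∈ R₂) :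
    (∀ κ : C → ℝ≥0, RegionEquiv c κ κ₀ →
      ∃ Δ₁ : ℝ≥0, (fun x => κ x + Δ₁) ∈ R₁ ∧
        ∀ Δ₂ : ℝ≥0, (fun x => κ x + Δ₂) ∈ R₂ → Δ₁ < Δ₂) ∨
    (∀ κ : C → ℝ≥0, RegionEquiv c κ κ₀ →
      ∀ Δ₁ : ℝ≥0, (fun x => κ x + Δ₁) ∈ R₁ →
        ∃ Δ₂ : ℝ≥0, Δ₂ ≤ Δ₁ ∧ (fun x => κ x + Δ₂) ∈ R₂) := by
  obtain ⟨ρ₁, rfl⟩ := hR₁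
  obtain ⟨ρ₂, rfl⟩ := hR₂
  simp only [Set.mem_ofPred_eq] at *
  refine or_iff_not_imp_right.2 fun hnot => ?_
  push Not at hnot
  obtain ⟨κ, hκ, d₁, hd₁, hno⟩ := hnot
  intro κ' hκ'
  have hκκ' := hκ.trans hκ'.symm
  obtain ⟨d₁', hd₁'⟩ := hκκ'.exists_delay d₁
  refine ⟨d₁', hd₁.trans hd₁', fun d₂' hd₂' => not_le.1 fun hle => ?_⟩
  obtain ⟨d₂, e₁, hde, hd₂, he₁⟩ := hκκ'.symm.exists_delay_pair hle
  have hd₂R := hd₂'.trans hd₂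
  have hlt : d₁ < d₂ := not_le.1 fun hle' => hno d₂ hle' hd₂R
  have hmid := (hd₁'.trans he₁).add_of_le_of_le hlt.le hde
  exact hno d₁ le_rfl (hd₂R.trans hmid.symm)
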